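/- Let n ≥ 1 and let H, A_1, …, A_s ∈ M_n(ℂ), where H has n pairwise distinct eigenvalues. Then the matrices H, A_1, …, A_s have a common eigenvector (a nonzero v ∈ ℂⁿ that is an eigenvector of H and of each A_i) if and only if the subspace N(H, A_1, …, A_s) = ⋂_{k=1}^{n-1} ⋂_{i=1}^{s} ker [H^k, A_i] is nonzero. -/

import Mathlib

open Polynomial in
theorem Polynomial.nodup_roots_of_natDegree_le_card_toFinset {K : Type*} [Field K]
    [DecidableEq K] {p : K[X]} (h : p.natDegree ≤ p.roots.toFinset.card) : p.roots.Nodup :=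
  Multiset.toFinset_card_eq_card_iff_nodup.mp
    (le_antisymm (Multiset.toFinset_card_le _) (p.card_roots'.trans h))

open Polynomial in
theorem Polynomial.Monic.nodal_roots_toFinset {K : Type*} [Field K] [DecidableEq K] {p : K[X]}
    (hp : p.Monic) (h : p.natDegree ≤ p.roots.toFinset.card) :
    Lagrange.nodal p.roots.toFinset id = p := by
  have hnodup := nodup_roots_of_natDegree_le_card_toFinset h
  have hcard : p.roots.card = p.natDegree :=
    le_antisymm p.card_roots' (h.trans (Multiset.toFinset_card_le _))
  conv_rhs => rw [← prod_multiset_X_sub_C_of_monic_of_roots_card_eq hp hcard]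
  rw [Lagrange.nodal_eq, Finset.prod, Multiset.toFinset_val, hnodup.dedup]
  simp

open Polynomial in
theorem Lagrange.X_sub_C_mul_basis {K ι : Type*} [Field K] [DecidableEq ι] {S : Finset ι}
    {x : ι → K} {i : ι} (hi : i ∈ S) :
    (X - C (x i)) * Lagrange.basis S x i = C (nodalWeight S x i) * nodal S x := by
  rw [basis_eq_prod_sub_inv_mul_nodal_div hi, ← nodal_erase_eq_nodal_div hi,
    nodal_eq_mul_nodal_erase hi]
  ring

namespace Matrix

variable {K ι : Type*} [Field K] [Fintype ι] [DecidableEq ι]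

/-- An eigenvector of `H` for a simple root of the characteristic polynomial spans its
eigenspace. -/
theorem exists_eq_smul_of_mulVec_eq_smul {H : Matrix ι ι K} {μ : K}
    (hμ : H.charpoly.rootMultiplicity μ ≤ 1) {w x : ι → K} (hw : w ≠ 0)
    (hHw : H *ᵥ w = μ • w) (hHx : H *ᵥ x = μ • x) : ∃ c : K, x = c • w := by
  have hrank : Module.finrank K (Module.End.eigenspace H.mulVecLin μ) ≤ 1 :=
    (LinearMap.finrank_eigenspace_le _ _).trans (by rwa [Matrix.charpoly_mulVecLin])
  have hwmem : w ∈ Module.End.eigenspace H.mulVecLin μ := Module.End.mem_eigenspace_iff.mpr hHw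
  have hxmem : x ∈ Module.End.eigenspace H.mulVecLin μ := Module.End.mem_eigenspace_iff.mpr hHx
  have hw' : (⟨w, hwmem⟩ : Module.End.eigenspace H.mulVecLin μ) ≠ 0 := by simpa using hw
  have hone : Module.finrank K (Module.End.eigenspace H.mulVecLin μ) = 1 :=
    le_antisymm hrank (Module.finrank_pos_iff_exists_ne_zero.mpr ⟨_, hw'⟩)
  obtain ⟨c, hc⟩ := (finrank_eq_one_iff_of_nonzero' _ hw').mp hone ⟨x, hxmem⟩
  exact ⟨c, (congrArg Subtype.val hc).symm⟩

open Polynomial in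
theorem mulVec_aeval_mulVec_of_natDegree_lt {H A : Matrix ι ι K} {v : ι → K} {d : ℕ} {p : K[X]}
    (hp : p.natDegree < d) (hv : ∀ k < d, A *ᵥ (H ^ k *ᵥ v) = H ^ k *ᵥ (A *ᵥ v)) :
    A *ᵥ (aeval H p *ᵥ v) = aeval H p *ᵥ (A *ᵥ v) := by
  rw [aeval_eq_sum_range' hp, sum_mulVec, sum_mulVec, mulVec_sum]
  refine Finset.sum_congr rfl fun k hk ↦ ?_
  rw [smul_mulVec, smul_mulVec, mulVec_smul, hv k (Finset.mem_range.mp hk)]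

theorem pow_mulVec_of_mulVec_eq_smul {H : Matrix ι ι K} {μ : K} {v : ι → K}
    (h : H *ᵥ v = μ • v) (k : ℕ) : H ^ k *ᵥ v = μ ^ k • v := by
  induction k with
  | zero => simp
  | succ k ih => rw [pow_succ, ← mulVec_mulVec, h, mulVec_smul, ih, smul_smul, pow_succ']

open Polynomial in
/-- The value at `H` of the Lagrange basis polynomial at `μ` maps into the `μ`-eigenspace. -/
theorem mulVec_aeval_basis_mulVec {H : Matrix ι ι K} {S : Finset K} [DecidableEq K]
    (hS : Lagrange.nodal S id = H.charpoly) {μ : K} (hμ : μ ∈ S) (x : ι → K) :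
    H *ᵥ (aeval H (Lagrange.basis S id μ) *ᵥ x) =
      μ • (aeval H (Lagrange.basis S id μ) *ᵥ x) := by
  have h := congrArg (aeval H) (Lagrange.X_sub_C_mul_basis (x := id) hμ)
  rw [hS, map_mul, map_mul, aeval_self_charpoly, mul_zero, map_sub, aeval_X, aeval_C, id,
    sub_mul, sub_eq_zero, ← Algebra.smul_def] at h
  rw [mulVec_mulVec, h, smul_mulVec]

end Matrix

/-- **Generalized Shemesh criterion.** Let `H, A_1, …, A_s ∈ M_n(ℂ)` where `H` has `n`
pairwise distinct eigenvalues (its characteristic polynomial has `n` distinct roots).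
Then `H, A_1, …, A_s` have a common eigenvector if and only if
`N(H, A_1, …, A_s) = ⋂_{k=1}^{n-1} ⋂_{i=1}^{s} ker [H^k, A_i]` is nonzero. -/
theorem generalized_shemesh (n s : ℕ) (hn : 1 ≤ n)
    (H : Matrix (Fin n) (Fin n) ℂ) (A : Fin s → Matrix (Fin n) (Fin n) ℂ)
    (hH : H.charpoly.roots.toFinset.card = n) :
    (∃ v : Fin n → ℂ, v ≠ 0 ∧ (∃ μ : ℂ, H.mulVec v = μ • v) ∧
        ∀ i : Fin s, ∃ α : ℂ, (A i).mulVec v = α • v) ↔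
      (⨅ k ∈ Finset.Icc 1 (n - 1), ⨅ i : Fin s,
        LinearMap.ker (H ^ k * A i - A i * H ^ k).mulVecLin) ≠ ⊥ := by
  classical
  have hmem : ∀ v : Fin n → ℂ, v ∈ (⨅ k ∈ Finset.Icc 1 (n - 1), ⨅ i : Fin s,
      LinearMap.ker (H ^ k * A i - A i * H ^ k).mulVecLin) ↔
      ∀ k, 1 ≤ k → k ≤ n - 1 → ∀ i,
        (H ^ k).mulVec ((A i).mulVec v) = (A i).mulVec ((H ^ k).mulVec v) := fun v ↦ by
    simp [Submodule.mem_iInf, sub_eq_zero]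
  rw [Submodule.ne_bot_iff]
  constructor
  · rintro ⟨v, hv, ⟨μ, hμ⟩, hA⟩
    refine ⟨v, (hmem v).mpr fun k _ _ i ↦ ?_, hv⟩
    obtain ⟨α, hα⟩ := hA i
    rw [hα, Matrix.mulVec_smul, Matrix.pow_mulVec_of_mulVec_eq_smul hμ, Matrix.mulVec_smul, hα,
      smul_comm]
  · rintro ⟨v, hvN, hv⟩
    have hcomm : ∀ i, ∀ k < n, (A i).mulVec ((H ^ k).mulVec v) =
        (H ^ k).mulVec ((A i).mulVec v) := fun i k hk ↦ by
      rcases Nat.eq_zero_or_pos k with rfl | hk0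
      · simp
      · exact ((hmem v).mp hvN k hk0 (by lia) i).symm
    have hdeg : H.charpoly.natDegree ≤ H.charpoly.roots.toFinset.card := by
      rw [hH, Matrix.charpoly_natDegree_eq_dim, Fintype.card_fin]
    have hnodal := H.charpoly_monic.nodal_roots_toFinset hdeg
    have hsimple : ∀ μ, H.charpoly.rootMultiplicity μ ≤ 1 := fun μ ↦ by
      rw [← Polynomial.count_roots]
      exact Multiset.nodup_iff_count_le_one.mp
        (Polynomial.nodup_roots_of_natDegree_le_card_toFinset hdeg) μ
    generalize H.charpoly.roots.toFinset = S at hH hnodal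
    have hinj : Set.InjOn (id : ℂ → ℂ) S := Function.injective_id.injOn
    obtain ⟨μ, hμ, hw⟩ : ∃ μ ∈ S,
        (Polynomial.aeval H (Lagrange.basis S id μ)).mulVec v ≠ 0 := by
      by_contra! hzero
      apply hv
      rw [← Matrix.one_mulVec v, ← map_one (Polynomial.aeval (R := ℂ) H),
        ← Lagrange.sum_basis hinj (Finset.card_pos.mp (by lia)), map_sum, Matrix.sum_mulVec]
      exact Finset.sum_eq_zero hzero
    have hwμ := Matrix.mulVec_aeval_basis_mulVec hnodal hμ
    refine ⟨_, hw, ⟨μ, hwμ v⟩, fun i ↦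
      Matrix.exists_eq_smul_of_mulVec_eq_smul (hsimple μ) hw (hwμ v) ?_⟩
    rw [Matrix.mulVec_aeval_mulVec_of_natDegree_lt (d := n)
      (by rw [Lagrange.natDegree_basis hinj hμ]; lia) (hcomm i)]
    exact hwμ _
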